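/- If k = ∑_{j=1}^J k_j χ_{E_j} with |k_j| ≤ k̄/ρ₀⁴, the E_j disjoint sets of finite perimeter partitioning Ω with |Ω| ≤ M₁ρ₀² and perimeters P(E_j) ≤ 𝒫ρ₀ for all j, then for every s ∈ (0, 1/2), [k]_s² ≤ C_s k̄² M₁^{1−2s} (J𝒫)^{2s} ρ₀^{−6−2s}, where C_s depends only on s. -/

import Mathlib

open MeasureTheory Metric Set
open scoped ENNReal

noncomputable section

abbrev E2 := EuclideanSpace ℝ (Fin 2)

/-- Divergence of a vector field on ℝ². -/
def diverg (φ : E2 → E2) (x : E2) : ℝ :=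
  ∑ i, fderiv ℝ φ x (EuclideanSpace.single i 1) i

/-- Admissible test vector fields for the total variation: `C¹` compactly
supported with `|φ| ≤ 1`. -/
def TVTest (φ : E2 → E2) : Prop :=
  ContDiff ℝ 1 φ ∧ HasCompactSupport φ ∧ ∀ x, ‖φ x‖ ≤ 1

/-- `V` bounds the total variation `∫_{ℝ²} |Dk|` of `k`:
`∫ k div φ ≤ V` for all admissible `φ`. -/
def TVBound (k : E2 → ℝ) (V : ℝ) : Prop :=
  ∀ φ : E2 → E2, TVTest φ → (∫ x, k x * diverg φ x) ≤ V

/-- The squared Gagliardo `H^s` seminorm of `k` on `ℝ²` (as an `ℝ≥0∞`-valued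
double integral). -/
def gagliardoSq (s : ℝ) (k : E2 → ℝ) : ℝ≥0∞ :=
  ∫⁻ x, ∫⁻ y, ENNReal.ofReal ((k x - k y) ^ 2 / dist x y ^ (2 + 2 * s))

lemma approx_ind (A : Set E2) (hA : MeasurableSet A) (hfin : volume A ≠ ∞) (ε : ℝ) (hε : 0 < ε) :
    ∃ ψ : E2 → ℝ, ContDiff ℝ 1 ψ ∧ HasCompactSupport ψ ∧ (∀ x, 0 ≤ ψ x ∧ ψ x ≤ 1) ∧
      ∫ x, |A.indicator (fun _ => (1:ℝ)) x - ψ x| ≤ ε := by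
  have hε2 : ENNReal.ofReal (ε/2) ≠ 0 := by simp; linarith
  obtain ⟨K, hKA, hK, hKd⟩ := hA.exists_isCompact_sdiff_lt hfin hε2
  obtain ⟨U, hKU, hU, hUt, hUd⟩ := hK.measurableSet.exists_isOpen_sdiff_lt
    (hK.measure_lt_top (μ := volume)).ne hε2
  obtain ⟨r, hr⟩ := hK.isBounded.subset_ball (0 : E2)
  obtain ⟨ψ, h1, h2, h3, h4⟩ := exists_contMDiff_support_eq_eq_one_iff (n := 1)
    (modelWithCornersSelf ℝ E2) (hU.inter isOpen_ball) hK.isClosed (subset_inter hKU hr)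
  have hc : ContDiff ℝ 1 ψ := h1.contDiff
  have hcs : HasCompactSupport ψ := by
    apply HasCompactSupport.of_support_subset_isCompact (isCompact_closedBall (0:E2) r)
    rw [h3]; exact inter_subset_right.trans ball_subset_closedBall
  have hb : ∀ x, 0 ≤ ψ x ∧ ψ x ≤ 1 := fun x => h2 (mem_range_self x)
  refine ⟨ψ, hc, hcs, hb, ?_⟩
  have hAK : MeasurableSet (A \ K) := hA.diff hK.measurableSet
  have hUK : MeasurableSet (U \ K) := hU.measurableSet.diff hK.measurableSet
  have i1 : Integrable ((A \ K).indicator (fun _ => (1:ℝ))) :=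
    (integrable_indicator_iff hAK).2 (integrableOn_const (hKd.trans ENNReal.ofReal_lt_top).ne)
  have i2 : Integrable ((U \ K).indicator (fun _ => (1:ℝ))) :=
    (integrable_indicator_iff hUK).2 (integrableOn_const (hUd.trans ENNReal.ofReal_lt_top).ne)
  have key : ∀ x, |A.indicator (fun _ => (1:ℝ)) x - ψ x| ≤
      (A \ K).indicator (fun _ => (1:ℝ)) x + (U \ K).indicator (fun _ => (1:ℝ)) x := by
    intro x
    by_cases hxK : x ∈ K
    · have : ψ x = 1 := (h4 x).1 hxK
      simp [hKA hxK, this, hxK]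
    · by_cases hxU : x ∈ U
      · have := hb x
        by_cases hxA : x ∈ A <;> simp [hxK, hxU, hxA] <;> rw [abs_le] <;> constructor <;> linarith
      · have : ψ x = 0 := by
          by_contra hne
          have : x ∈ Function.support ψ := hne
          rw [h3] at this; exact hxU this.1
        by_cases hxA : x ∈ A <;> simp [hxK, hxU, hxA, this]
  calc ∫ x, |A.indicator (fun _ => (1:ℝ)) x - ψ x| ≤ ∫ x, ((A \ K).indicator (fun _ => (1:ℝ)) x + (U \ K).indicator (fun _ => (1:ℝ)) x) :=
        integral_mono_of_nonneg (.of_forall fun x => abs_nonneg _) (i1.add i2) (.of_forall key)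
    _ = volume.real (A \ K) + volume.real (U \ K) := by
        rw [integral_add i1 i2, integral_indicator_const _ hAK, integral_indicator_const _ hUK]; simp
    _ ≤ ε/2 + ε/2 := by
        gcongr
        · exact ENNReal.toReal_le_of_le_ofReal (by linarith) hKd.le
        · exact ENNReal.toReal_le_of_le_ofReal (by linarith) hUd.le
    _ = ε := by ring

lemma tv_dir (k : E2 → ℝ) (V : ℝ) (hV : TVBound k V) (ψ : E2 → ℝ) (hc : ContDiff ℝ 1 ψ)
    (hcs : HasCompactSupport ψ) (hb : ∀ x, |ψ x| ≤ 1) (h : E2) :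
    ∫ x, k x * fderiv ℝ ψ x h ≤ V * ‖h‖ := by
  by_cases h0 : h = 0
  · simp [h0]
  have hn : 0 < ‖h‖ := norm_pos_iff.2 h0
  set v : E2 := ‖h‖⁻¹ • h with hv
  have hvn : ‖v‖ = 1 := by rw [hv, norm_smul, norm_inv, norm_norm, inv_mul_cancel₀ hn.ne']
  have T : TVTest (fun x => ψ x • v) := by
    refine ⟨hc.smul contDiff_const, hcs.smul_right, fun x => ?_⟩
    rw [norm_smul, hvn, mul_one]; exact hb x
  have := hV _ T
  have hd : ∀ x, diverg (fun x => ψ x • v) x = ‖h‖⁻¹ * fderiv ℝ ψ x h := by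
    intro x
    have hdx : DifferentiableAt ℝ ψ x := hc.differentiable (by norm_num) x
    unfold diverg
    rw [fderiv_smul_const hdx]
    have : ‖h‖⁻¹ * fderiv ℝ ψ x h = fderiv ℝ ψ x v := by simp [hv]
    rw [this]
    have hv2 : v = ∑ i, v i • EuclideanSpace.single i (1:ℝ) := by
      ext j; fin_cases j <;> simp 
    conv_rhs => rw [hv2]
    simp [mul_comm]
  simp_rw [hd] at this
  have e : ∫ x, k x * fderiv ℝ ψ x h = ‖h‖ * ∫ x, k x * (‖h‖⁻¹ * fderiv ℝ ψ x h) := by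
    rw [← integral_const_mul]; congr 1; ext x; field_simp
  rw [e, mul_comm]; gcongr

lemma tv_transl (E : Set E2) (hE : MeasurableSet E) (hfin : volume E ≠ ∞) (V : ℝ)
    (hV : TVBound (E.indicator fun _ => (1:ℝ)) V) (ψ : E2 → ℝ) (hc : ContDiff ℝ 1 ψ)
    (hcs : HasCompactSupport ψ) (hb : ∀ x, |ψ x| ≤ 1) (h : E2) :
    ∫ x, E.indicator (fun _ => (1:ℝ)) x * (ψ (x - h) - ψ x) ≤ V * ‖h‖ := by
  set f := E.indicator (fun _ => (1:ℝ)) with hf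
  have hfm : Measurable f := measurable_const.indicator hE
  have hfi : Integrable f := (integrable_indicator_iff hE).2 (integrableOn_const hfin)
  have hcf : Continuous (fderiv ℝ ψ) := hc.continuous_fderiv (by norm_num)
  obtain ⟨D, hD⟩ := hcf.bounded_above_of_compact_support (hcs.fderiv (𝕜 := ℝ))
  have e1 : ∀ x, ψ (x - h) - ψ x = ∫ t in (0:ℝ)..1, fderiv ℝ ψ (x - t • h) (-h) := by
    intro x
    rw [intervalIntegral.integral_eq_sub_of_hasDerivAt (f := fun t : ℝ => ψ (x - t • h))]
    · simp
    · intro t _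
      have h1 : HasFDerivAt ψ (fderiv ℝ ψ (x - t • h)) (x - t • h) :=
        (hc.differentiable (by norm_num) _).hasFDerivAt
      have h2 : HasDerivAt (fun t : ℝ => x - t • h) (-h) t := by
        simpa using ((hasDerivAt_id t).smul_const h).const_sub x
      exact h1.comp_hasDerivAt t h2
    · apply Continuous.intervalIntegrable
      fun_prop
  have hint : Integrable (Function.uncurry fun (x : E2) (t : ℝ) => f x * fderiv ℝ ψ (x - t • h) (-h))
      (volume.prod (volume.restrict (Ioc (0:ℝ) 1))) := by
    have g : Integrable (fun z : E2 × ℝ => f z.1) (volume.prod (volume.restrict (Ioc (0:ℝ) 1))) :=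
      hfi.comp_fst _
    refine (g.bdd_mul (c := D * ‖h‖) (f := fun z : E2 × ℝ => fderiv ℝ ψ (z.1 - z.2 • h) (-h)) ?_ ?_).congr ?_
    · apply Continuous.aestronglyMeasurable; fun_prop
    · refine .of_forall fun z => ?_
      refine ((fderiv ℝ ψ (z.1 - z.2 • h)).le_opNorm _).trans ?_
      rw [norm_neg]; gcongr; exact hD _
    · refine .of_forall fun z => ?_
      simp [Function.uncurry, mul_comm]
  have e2 : ∫ x, f x * (ψ (x - h) - ψ x) =
      ∫ t in Ioc (0:ℝ) 1, ∫ x, f x * fderiv ℝ ψ (x - t • h) (-h) := by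
    rw [← integral_integral_swap hint]
    congr 1; ext x
    rw [e1, intervalIntegral.integral_of_le (by norm_num), integral_const_mul]
  rw [e2]
  have e3 : ∀ t : ℝ, ∫ x, f x * fderiv ℝ ψ (x - t • h) (-h) ≤ V * ‖h‖ := by
    intro t
    have := tv_dir f V hV (fun x => ψ (x - t • h)) (hc.comp (contDiff_id.sub contDiff_const))
      (hcs.comp_homeomorph (Homeomorph.subRight (t • h))) (fun x => hb _) (-h)
    simp_rw [norm_neg] at this
    convert this using 4 with x
    rw [fderiv_comp_sub]
  calc _ ≤ ∫ t in Ioc (0:ℝ) 1, V * ‖h‖ := by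
        refine integral_mono_ae hint.integral_prod_right (integrable_const _) (.of_forall e3)
    _ = _ := by simp

lemma tv_diff (E : Set E2) (hE : MeasurableSet E) (hfin : volume E ≠ ∞) (V : ℝ)
    (hV : TVBound (E.indicator fun _ => (1:ℝ)) V) (h : E2) :
    ∫⁻ x, ENNReal.ofReal ((E.indicator (fun _ => (1:ℝ)) x - E.indicator (fun _ => (1:ℝ)) (x + h)) ^ 2)
      ≤ ENNReal.ofReal (V * ‖h‖) := by
  set f := E.indicator (fun _ => (1:ℝ)) with hf
  have hfm : Measurable f := measurable_const.indicator hE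
  have hfi : Integrable f := (integrable_indicator_iff hE).2 (integrableOn_const hfin)
  have hf01 : ∀ x, 0 ≤ f x ∧ f x ≤ 1 := fun x => by
    by_cases hx : x ∈ E <;> simp [hf, hx]
  have hgi : Integrable (fun x => f (x + h)) := hfi.comp_add_right h
  have hdb : ∀ x, |f x - f (x + h)| ≤ 1 := fun x => by
    have := hf01 x; have := hf01 (x + h); rw [abs_le]; constructor <;> linarith
  have hdi : Integrable (fun x => f x - f (x + h)) := hfi.sub hgi
  have hsq : Integrable (fun x => (f x - f (x + h)) ^ 2) := by
    simp_rw [sq]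
    exact hdi.bdd_mul (c := 1) hdi.aestronglyMeasurable (.of_forall hdb)
  rw [← ofReal_integral_eq_lintegral_ofReal hsq (.of_forall fun x => sq_nonneg _)]
  apply ENNReal.ofReal_le_ofReal
  refine le_of_forall_pos_le_add fun ε hε => ?_
  obtain ⟨ψ₁, c1, s1, b1, a1⟩ := approx_ind E hE hfin (ε/2) (by linarith)
  set ψ : E2 → ℝ := fun x => ψ₁ (x + h) - ψ₁ x with hψ
  have cc : ContDiff ℝ 1 (fun x => ψ₁ (x + h)) := c1.comp (contDiff_id.add contDiff_const)
  have ss : HasCompactSupport (fun x => ψ₁ (x + h)) := s1.comp_homeomorph (Homeomorph.addRight h)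
  have cψ : ContDiff ℝ 1 ψ := cc.sub c1
  have sψ : HasCompactSupport ψ := ss.sub s1
  have bψ : ∀ x, |ψ x| ≤ 1 := fun x => by
    have := b1 x; have := b1 (x + h); rw [hψ, abs_le]; constructor <;> simp only <;> linarith
  have iψ₁ : Integrable ψ₁ := c1.continuous.integrable_of_hasCompactSupport s1
  have iψ : Integrable ψ := cψ.continuous.integrable_of_hasCompactSupport sψ
  have T := tv_transl E hE hfin V hV ψ cψ sψ bψ h
  rw [← hf] at T
  have bmul : ∀ u : E2 → ℝ, Integrable u → Integrable (fun x => u x * ψ x) := fun u hu =>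
    hu.mul_bdd (c := 1) cψ.continuous.aestronglyMeasurable (.of_forall bψ)
  have j1 : Integrable (fun x => f x * ψ (x - h)) :=
    hfi.mul_bdd (c := 1) (cψ.continuous.comp (continuous_id.sub continuous_const)).aestronglyMeasurable
      (.of_forall fun x => bψ _)
  have eT : ∫ x, f x * (ψ (x - h) - ψ x) = ∫ x, (f (x + h) - f x) * ψ x := by
    simp_rw [mul_sub, sub_mul]
    rw [integral_sub j1 (bmul f hfi), integral_sub (bmul _ hgi) (bmul f hfi)]
    congr 1
    rw [← integral_add_right_eq_self _ h]
    simp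
  rw [eT] at T
  have ia : Integrable (fun x => |f x - ψ₁ x|) := (hfi.sub iψ₁).abs
  have ia' : Integrable (fun x => |f (x+h) - ψ₁ (x+h)|) := ia.comp_add_right h
  have ib : Integrable (fun x => (f (x + h) - f x) * ψ x) := bmul _ (hgi.sub hfi)
  have pw : ∀ x, (f x - f (x + h)) ^ 2 ≤
      (f (x + h) - f x) * ψ x + (|f (x+h) - ψ₁ (x+h)| + |f x - ψ₁ x|) := by
    intro x
    have e : (f x - f (x + h)) ^ 2 = (f (x + h) - f x) * ψ x +
      (f (x + h) - f x) * ((f (x+h) - ψ₁ (x+h)) - (f x - ψ₁ x)) := by simp only [hψ]; ring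
    rw [e]
    gcongr
    refine (le_abs_self _).trans ?_
    rw [abs_mul, abs_sub_comm]
    calc _ ≤ 1 * |(f (x+h) - ψ₁ (x+h)) - (f x - ψ₁ x)| := by gcongr; exact hdb x
      _ ≤ _ := by rw [one_mul]; exact abs_sub _ _
  calc ∫ x, (f x - f (x + h)) ^ 2 ≤ ∫ x, ((f (x + h) - f x) * ψ x + (|f (x+h) - ψ₁ (x+h)| + |f x - ψ₁ x|)) :=
        integral_mono hsq (ib.add (ia'.add ia)) pw
    _ = (∫ x, (f (x + h) - f x) * ψ x) + ((∫ x, |f x - ψ₁ x|) + ∫ x, |f x - ψ₁ x|) := by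
        rw [integral_add ib (by exact ia'.add ia), integral_add ia' ia,
          integral_add_right_eq_self (fun x => |f x - ψ₁ x|) h]
    _ ≤ V * ‖h‖ + (ε/2 + ε/2) := by gcongr
    _ = _ := by ring

lemma g_integrable (s : ℝ) (hs0 : 0 < s) (hs1 : s < 1 / 2) :
    Integrable (fun u : E2 => min ‖u‖ 1 / ‖u‖ ^ (2 + 2 * s)) := by
  rw [integrable_fun_norm_addHaar (E := E2) volume (f := fun r : ℝ => min r 1 / r ^ (2 + 2 * s))]
  have hd : Module.finrank ℝ E2 - 1 = 1 := by simp
  rw [hd, ← Ioc_union_Ioi_eq_Ioi (zero_le_one (α := ℝ)), integrableOn_union]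
  constructor
  · have h1 : IntegrableOn (fun y : ℝ => y ^ (-(2 * s))) (Ioc 0 1) := by
      rw [← intervalIntegrable_iff_integrableOn_Ioc_of_le zero_le_one]
      exact intervalIntegral.intervalIntegrable_rpow' (by linarith)
    refine h1.congr_fun (fun y hy => ?_) measurableSet_Ioc
    have hy0 : 0 < y := hy.1
    simp only [min_eq_left hy.2, pow_one, smul_eq_mul]
    rw [Real.rpow_add hy0, Real.rpow_neg hy0.le, Real.rpow_two]
    field_simp
  · have h1 : IntegrableOn (fun y : ℝ => y ^ (-1 - 2 * s)) (Ioi 1) :=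
      integrableOn_Ioi_rpow_of_lt (by linarith) zero_lt_one
    refine h1.congr_fun (fun y hy => ?_) measurableSet_Ioi
    have hy1 : 1 < y := hy
    have hy0 : 0 < y := by linarith
    simp only [min_eq_right hy1.le, pow_one, smul_eq_mul]
    rw [Real.rpow_add hy0, Real.rpow_sub hy0, Real.rpow_neg hy0.le, Real.rpow_two, Real.rpow_one]
    field_simp

lemma scaled (s : ℝ) (hs0 : 0 < s) (hs1 : s < 1 / 2) (A B : ℝ) (hA : 0 < A) (hB : 0 < B) :
    ∫⁻ h : E2, ENNReal.ofReal (min (A * ‖h‖) B / ‖h‖ ^ (2 + 2 * s)) =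
      ENNReal.ofReal (B ^ (1 - 2 * s) * A ^ (2 * s) *
        ∫ u : E2, min ‖u‖ 1 / ‖u‖ ^ (2 + 2 * s)) := by
  set g : E2 → ℝ := fun u => min ‖u‖ 1 / ‖u‖ ^ (2 + 2 * s) with hg
  have gi : Integrable g := g_integrable s hs0 hs1
  set R := B / A with hR
  have hR0 : 0 < R := div_pos hB hA
  have e : ∀ h : E2, min (A * ‖h‖) B / ‖h‖ ^ (2 + 2 * s) =
      B * R ^ (-(2 + 2 * s)) * g (R⁻¹ • h) := by
    intro h
    simp only [hg, norm_smul, norm_inv, Real.norm_eq_abs, abs_of_pos hR0]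
    rw [Real.mul_rpow (by positivity) (norm_nonneg _), Real.inv_rpow hR0.le, Real.rpow_neg hR0.le]
    have : min (A * ‖h‖) B = B * min (R⁻¹ * ‖h‖) 1 := by
      rw [mul_min_of_nonneg _ _ hB.le, mul_one]
      congr 1
      rw [hR]; field_simp
    rw [this]
    have : 0 < R ^ (2 + 2 * s) := by positivity
    field_simp
  simp_rw [e]
  have gi' : Integrable (fun h => g (R⁻¹ • h)) := gi.comp_smul (inv_ne_zero hR0.ne')
  rw [← ofReal_integral_eq_lintegral_ofReal (gi'.const_mul _)
    (.of_forall fun h => by simp only [hg, Pi.zero_apply]; positivity)]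
  congr 1
  rw [integral_const_mul, Measure.integral_comp_inv_smul_of_nonneg _ _ hR0.le]
  simp only [finrank_euclideanSpace, Fintype.card_fin, smul_eq_mul]
  rw [← mul_assoc]
  congr 1
  have : B * R ^ (-(2 + 2 * s)) * R ^ 2 = B * R ^ (-(2*s)) := by
    rw [← Real.rpow_natCast R 2, mul_assoc, ← Real.rpow_add hR0]
    congr 2; push_cast; ring
  rw [this, hR, Real.div_rpow hB.le hA.le, Real.rpow_neg hB.le, Real.rpow_neg hA.le,
    Real.rpow_sub hB, Real.rpow_one]
  field_simp

lemma gag_change (s : ℝ) (k : E2 → ℝ) (hk : Measurable k) :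
    gagliardoSq s k = ∫⁻ h : E2, ∫⁻ x : E2, ENNReal.ofReal ((k x - k (x + h)) ^ 2 / ‖h‖ ^ (2 + 2 * s)) := by
  unfold gagliardoSq
  symm
  rw [lintegral_lintegral_swap]
  · congr 1; ext x
    symm
    rw [← lintegral_add_left_eq_self _ x]
    congr 1; ext h
    simp [dist_eq_norm]
  · apply Measurable.aemeasurable
    simp only [Function.uncurry_def]
    fun_prop

lemma pointwise_bd (J : ℕ) (E : Fin J → Set E2) (kc : Fin J → ℝ) (K : ℝ)
    (hE : Pairwise (Function.onFun Disjoint E)) (hK : ∀ j, |kc j| ≤ K) (x y : E2) :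
    (∑ j, kc j * Set.indicator (E j) (fun _ => (1:ℝ)) x -
      ∑ j, kc j * Set.indicator (E j) (fun _ => (1:ℝ)) y) ^ 2 ≤
    2 * K ^ 2 * ∑ j, (Set.indicator (E j) (fun _ => (1:ℝ)) x -
      Set.indicator (E j) (fun _ => (1:ℝ)) y) ^ 2 := by
  set f : Fin J → E2 → ℝ := fun j => Set.indicator (E j) (fun _ => (1:ℝ)) with hf
  change (∑ j, kc j * f j x - ∑ j, kc j * f j y) ^ 2 ≤ 2 * K ^ 2 * ∑ j, (f j x - f j y) ^ 2
  have sum1 : ∀ z, ∑ j, f j z ≤ 1 := by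
    intro z
    by_cases hz : ∃ j, z ∈ E j
    · obtain ⟨j, hj⟩ := hz
      rw [Finset.sum_eq_single j]
      · simp [hf, hj]
      · intro i _ hij
        have : z ∉ E i := fun hi => Set.disjoint_left.1 (hE hij) hi hj
        simp [hf, this]
      · simp
    · push Not at hz
      rw [Finset.sum_eq_zero]
      · norm_num
      · intro j _; simp [hf, hz j]
  have nn : ∀ j z, 0 ≤ f j z := fun j z => Set.indicator_nonneg (fun _ _ => zero_le_one) _
  have sq : ∀ j, (f j x - f j y) ^ 2 = |f j x - f j y| := by
    intro j
    by_cases hx : x ∈ E j <;> by_cases hy : y ∈ E j <;> simp [hf, hx, hy]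
  simp_rw [sq]
  set S := ∑ j, |f j x - f j y| with hS
  have S0 : 0 ≤ S := Finset.sum_nonneg fun _ _ => abs_nonneg _
  have S2 : S ≤ 2 := by
    calc S ≤ ∑ j, (f j x + f j y) := Finset.sum_le_sum fun j _ => by
          have := nn j x; have := nn j y; rw [abs_le]; constructor <;> linarith
      _ = ∑ j, f j x + ∑ j, f j y := Finset.sum_add_distrib
      _ ≤ 2 := by linarith [sum1 x, sum1 y]
  have a : |∑ j, kc j * f j x - ∑ j, kc j * f j y| ≤ K * S := by
    rw [← Finset.sum_sub_distrib, hS, Finset.mul_sum]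
    refine (Finset.abs_sum_le_sum_abs _ _).trans (Finset.sum_le_sum fun j _ => ?_)
    rw [← mul_sub, abs_mul]
    gcongr; exact hK j
  rw [← sq_abs]
  calc _ ≤ (K * S) ^ 2 := by gcongr
    _ = K ^ 2 * S * S := by ring
    _ ≤ K ^ 2 * S * 2 := by gcongr
    _ = _ := by ring

lemma l1_diff (E : Set E2) (hE : MeasurableSet E) (h : E2) :
    ∫⁻ x, ENNReal.ofReal ((E.indicator (fun _ => (1:ℝ)) x - E.indicator (fun _ => (1:ℝ)) (x + h)) ^ 2)
      ≤ 2 * volume E := by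
  have m : Measurable (E.indicator (fun _ => (1:ℝ≥0∞))) := measurable_const.indicator hE
  calc _ ≤ ∫⁻ x, (E.indicator (fun _ => (1:ℝ≥0∞)) x + E.indicator (fun _ => (1:ℝ≥0∞)) (x + h)) := by
        apply lintegral_mono; intro x
        by_cases h1 : x ∈ E <;> by_cases h2 : x + h ∈ E <;> simp [h1, h2]
    _ = 2 * volume E := by
        rw [lintegral_add_left m, lintegral_add_right_eq_self (E.indicator (fun _ => (1:ℝ≥0∞))) h,
          lintegral_indicator hE]
        simp [two_mul]

/-- **Quantitative `H^s` bound for a piecewise constant Winkler coefficient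
(Remark 3.1).** If `k = ∑_j k_j χ_{E_j}` with `|k_j| ≤ k̄/ρ₀⁴`, the `E_j`
disjoint finite perimeter sets partitioning `Ω`, `|Ω| ≤ M₁ρ₀²`, and
`P(E_j) ≤ Pcal ρ₀` for all `j`, then for every `s ∈ (0,1/2)`,
`[k]_s² ≤ C_s k̄² M₁^{1−2s} (JPcal)^{2s} ρ₀^{−6−2s}`, with `C_s` depending only
on `s`. -/
theorem stmt11 (s : ℝ) (hs0 : 0 < s) (hs1 : s < 1 / 2) :
    ∃ C > (0:ℝ),
      ∀ (Ω : Set E2) (ρ₀ kbar M₁ Pcal : ℝ) (J : ℕ) (E : Fin J → Set E2) (kc : Fin J → ℝ),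
        0 < ρ₀ → 0 ≤ kbar → 0 < M₁ → 0 < Pcal →
        (∀ j, MeasurableSet (E j)) →
        Pairwise (Function.onFun Disjoint E) →
        (⋃ j, E j) = Ω →
        volume Ω ≤ ENNReal.ofReal (M₁ * ρ₀ ^ 2) →
        (∀ j, |kc j| ≤ kbar / ρ₀ ^ 4) →
        (∀ j, TVBound (Set.indicator (E j) fun _ => (1:ℝ)) (Pcal * ρ₀)) →
        gagliardoSq s (fun x => ∑ j, kc j * Set.indicator (E j) (fun _ => (1:ℝ)) x) ≤
          ENNReal.ofReal
            (C * kbar ^ 2 * M₁ ^ (1 - 2 * s) * ((J : ℝ) * Pcal) ^ (2 * s) *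
              ρ₀ ^ (-6 - 2 * s)) := by
  set I : ℝ := ∫ u : E2, min ‖u‖ 1 / ‖u‖ ^ (2 + 2 * s) with hI
  have I0 : 0 ≤ I := integral_nonneg fun u => by simp only [Pi.zero_apply]; positivity
  refine ⟨2 * 2 ^ (1 - 2 * s) * (I + 1), by positivity, ?_⟩
  intro Ω ρ kbar M P J E kc hρ hk hM hP hE hdis hΩ hvol hkc htv
  rcases Nat.eq_zero_or_pos J with hJ | hJ
  · subst hJ; simp [gagliardoSq]
  have hJ' : (0:ℝ) < J := by exact_mod_cast hJ
  set K := kbar / ρ ^ 4 with hK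
  have K0 : 0 ≤ K := by positivity
  set f : Fin J → E2 → ℝ := fun j => Set.indicator (E j) (fun _ => (1:ℝ)) with hf
  have fm : ∀ j, Measurable (f j) := fun j => measurable_const.indicator (hE j)
  have hsum : ∑ j, volume (E j) ≤ ENNReal.ofReal (M * ρ ^ 2) := by
    rw [← tsum_fintype (L := .unconditional _), ← measure_iUnion hdis hE, hΩ]; exact hvol
  have hfin : ∀ j, volume (E j) ≠ ∞ := fun j =>
    ((Finset.single_le_sum (f := fun j => volume (E j)) (fun _ _ => zero_le) (Finset.mem_univ j)).trans hsum).trans_lt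
      ENNReal.ofReal_lt_top |>.ne
  set A := (J * P) * ρ with hA
  set B := 2 * (M * ρ ^ 2) with hB
  have A0 : 0 < A := by positivity
  have B0 : 0 < B := by positivity
  have bound : ∀ h : E2, ∑ j, ∫⁻ x, ENNReal.ofReal ((f j x - f j (x + h)) ^ 2) ≤
      ENNReal.ofReal (min (A * ‖h‖) B) := by
    intro h
    rw [ENNReal.ofReal_min]
    refine le_min ?_ ?_
    · calc _ ≤ ∑ j : Fin J, ENNReal.ofReal (P * ρ * ‖h‖) :=
            Finset.sum_le_sum fun j _ => tv_diff (E j) (hE j) (hfin j) _ (htv j) h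
        _ = _ := by
            rw [← ENNReal.ofReal_sum_of_nonneg (fun _ _ => by positivity)]
            congr 1; simp [hA]; ring
    · calc _ ≤ ∑ j : Fin J, 2 * volume (E j) :=
            Finset.sum_le_sum fun j _ => l1_diff (E j) (hE j) h
        _ ≤ 2 * ENNReal.ofReal (M * ρ ^ 2) := by rw [← Finset.mul_sum]; gcongr
        _ = _ := by rw [hB, ENNReal.ofReal_mul (by norm_num : (0:ℝ) ≤ 2), ENNReal.ofReal_ofNat]
  rw [gag_change _ _ (Finset.measurable_sum _ fun j _ => (fm j).const_mul _)]
  calc _ ≤ ∫⁻ h : E2, ENNReal.ofReal (2 * K ^ 2) *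
        ENNReal.ofReal (min (A * ‖h‖) B / ‖h‖ ^ (2 + 2 * s)) := by
        apply lintegral_mono; intro h
        calc _ ≤ ∫⁻ x : E2, ENNReal.ofReal (2 * K ^ 2 / ‖h‖ ^ (2 + 2 * s)) *
              ∑ j, ENNReal.ofReal ((f j x - f j (x + h)) ^ 2) := by
              apply lintegral_mono; intro x
              simp only
              rw [← ENNReal.ofReal_sum_of_nonneg (fun _ _ => sq_nonneg _),
                ← ENNReal.ofReal_mul (by positivity)]
              apply ENNReal.ofReal_le_ofReal
              rw [div_mul_eq_mul_div]
              gcongr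
              exact pointwise_bd J E kc K hdis hkc x (x + h)
          _ = ENNReal.ofReal (2 * K ^ 2 / ‖h‖ ^ (2 + 2 * s)) *
              ∑ j, ∫⁻ x, ENNReal.ofReal ((f j x - f j (x + h)) ^ 2) := by
              rw [lintegral_const_mul, lintegral_finsetSum]
              · intro j _; have := fm j; fun_prop
              · refine Finset.measurable_sum _ fun j _ => ?_
                have := fm j; fun_prop
          _ ≤ ENNReal.ofReal (2 * K ^ 2 / ‖h‖ ^ (2 + 2 * s)) * ENNReal.ofReal (min (A * ‖h‖) B) := by
              gcongr; exact bound h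
          _ = _ := by
              simp only
              rw [← ENNReal.ofReal_mul (by positivity), ← ENNReal.ofReal_mul (by positivity)]
              congr 1; ring
    _ = ENNReal.ofReal (2 * K ^ 2 * (B ^ (1 - 2 * s) * A ^ (2 * s) * I)) := by
        rw [lintegral_const_mul' _ _ ENNReal.ofReal_ne_top, scaled s hs0 hs1 A B A0 B0,
          ← ENNReal.ofReal_mul (by positivity)]
    _ ≤ _ := by
        apply ENNReal.ofReal_le_ofReal
        have e : 2 * K ^ 2 * (B ^ (1 - 2 * s) * A ^ (2 * s) * I) =
            2 * 2 ^ (1 - 2 * s) * I * kbar ^ 2 * M ^ (1 - 2 * s) * ((J : ℝ) * P) ^ (2 * s) *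
              ρ ^ (-6 - 2 * s) := by
          have r1 : ρ ^ (-6 - 2 * s) = (ρ ^ 4)⁻¹ ^ 2 * (ρ ^ 2) ^ (1 - 2 * s) * ρ ^ (2 * s) := by
            rw [← Real.rpow_natCast ρ 4, ← Real.rpow_neg hρ.le, ← Real.rpow_natCast ρ 2,
              ← Real.rpow_mul hρ.le, ← Real.rpow_natCast _ 2, ← Real.rpow_mul hρ.le,
              ← Real.rpow_add hρ, ← Real.rpow_add hρ]
            congr 1; push_cast; ring
          rw [r1, hB, hA, hK, Real.mul_rpow (by positivity) hρ.le,
            Real.mul_rpow (by norm_num) (by positivity), Real.mul_rpow hM.le (by positivity)]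
          ring
        rw [e]
        gcongr
        linarith

end
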